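/- Let k ≥ 1 and let f be holomorphic on a neighborhood of (0,0) in ℂ × ℂ^k, written f(z,η), defining a k-parameter analytic family of local diffeomorphisms z ↦ f(z,η). Assume the origin is a double fixed point for η = 0, i.e. f(0,0) = 0, ∂f/∂z(0,0) = 1 and ∂²f/∂z²(0,0) ≠ 0, and assume the genericity condition ∂f/∂η_j(0,0) ≠ 0 for some j ∈ {1,…,k}. Then there exist a germ at 0 of biholomorphic change of parameters η ↦ (ε(η), ν(η)) ∈ ℂ × ℂ^{k−1} with ε(0) = 0, ν(0) = 0, and an analytic family of local biholomorphisms z ↦ φ(z,η) defined near z = 0, such that in the new coordinate z̄ = φ(z,η) and new parameters (ε,ν) the family becomes the prepared form f̄_{ε,ν}(z̄) = z̄ + (z̄² − ε)[1 + β(ε,ν) + A(ε,ν) z̄ + (z̄² − ε) Q(z̄,ε,ν)], where β, A, Q are analytic near the origin and β(0,0) = 0, and such that for every sufficiently small ε ≠ 0 and every s ∈ ℂ with s² = ε one has 1/s = 1/log(∂_z f̄_{ε,ν}(s)) − 1/log(∂_z f̄_{ε,ν}(−s)), using the principal branch of the logarithm. Moreover the function a(ε,ν) := 1/log(∂_z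 f̄_{ε,ν}(s)) + 1/log(∂_z f̄_{ε,ν}(−s)) is independent of the choice of the square root s of ε and extends to a function analytic in (ε,ν) at (0,0); finally the parameter ε is canonical: any other change of coordinates and parameters producing a prepared form with the same multiplier identity yields the same function η ↦ ε(η). -/

import Mathlib

open Filter Complex

/-- The prepared normal form
`z ↦ z + (z² - ε)(1 + β + A z + (z² - ε) Q(z))`. -/
noncomputable def preparedMap (ε bv av : ℂ) (Qv : ℂ → ℂ) : ℂ → ℂ :=
  fun z => z + (z ^ 2 - ε) * (1 + bv + av * z + (z ^ 2 - ε) * Qv z)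

/-- The data `(E, V, φ, β, A, Q, a)` puts the `k`-parameter family `f` in prepared form:
`η ↦ (E η, V η)` is a germ of biholomorphic change of parameters fixing the origin,
`z ↦ φ(z, η)` is an analytic family of local biholomorphisms, the conjugated family is
the prepared form with analytic data `β, A, Q` and `β(0,0) = 0`, the multiplier identity
`1/s = 1/log f̄'(s) - 1/log f̄'(-s)` holds for every square root `s` of `ε`, and
`a(ε,ν) = 1/log f̄'(s) + 1/log f̄'(-s)` is analytic. -/
def IsPreparedNormalization (k : ℕ) (f : ℂ → (Fin k → ℂ) → ℂ)
    (E : (Fin k → ℂ) → ℂ) (V : (Fin k → ℂ) → Fin (k - 1) → ℂ)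
    (φ : ℂ → (Fin k → ℂ) → ℂ)
    (bβ bA : ℂ → (Fin (k - 1) → ℂ) → ℂ)
    (Q : ℂ → ℂ → (Fin (k - 1) → ℂ) → ℂ)
    (a : ℂ → (Fin (k - 1) → ℂ) → ℂ) : Prop :=
  -- the change of parameters is analytic, fixes the origin, and is locally invertible
  AnalyticAt ℂ (fun η => (E η, V η)) (0 : Fin k → ℂ) ∧
  E 0 = 0 ∧ V 0 = 0 ∧
  (∃ Ginv : ℂ × (Fin (k - 1) → ℂ) → Fin k → ℂ,
      AnalyticAt ℂ Ginv (0 : ℂ × (Fin (k - 1) → ℂ)) ∧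
      (∀ᶠ η in nhds (0 : Fin k → ℂ), Ginv (E η, V η) = η) ∧
      (∀ᶠ p in nhds (0 : ℂ × (Fin (k - 1) → ℂ)), (E (Ginv p), V (Ginv p)) = p)) ∧
  -- the coordinate change is analytic and biholomorphic in `z`
  AnalyticAt ℂ (fun p : ℂ × (Fin k → ℂ) => φ p.1 p.2) (0 : ℂ × (Fin k → ℂ)) ∧
  φ 0 0 = 0 ∧
  deriv (fun z => φ z 0) 0 ≠ 0 ∧
  -- the data of the prepared form is analytic and `β(0,0) = 0`
  AnalyticAt ℂ (fun q : ℂ × (Fin (k - 1) → ℂ) => bβ q.1 q.2)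
    (0 : ℂ × (Fin (k - 1) → ℂ)) ∧
  AnalyticAt ℂ (fun q : ℂ × (Fin (k - 1) → ℂ) => bA q.1 q.2)
    (0 : ℂ × (Fin (k - 1) → ℂ)) ∧
  AnalyticAt ℂ (fun q : ℂ × ℂ × (Fin (k - 1) → ℂ) => Q q.1 q.2.1 q.2.2)
    (0 : ℂ × ℂ × (Fin (k - 1) → ℂ)) ∧
  bβ 0 0 = 0 ∧
  -- `φ` conjugates the family `f` to the prepared form
  (∀ᶠ p : ℂ × (Fin k → ℂ) in nhds 0,
      φ (f p.1 p.2) p.2 =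
        preparedMap (E p.2) (bβ (E p.2) (V p.2)) (bA (E p.2) (V p.2))
          (fun z => Q z (E p.2) (V p.2)) (φ p.1 p.2)) ∧
  -- the multiplier identity, for every square root `s` of `ε ≠ 0`
  (∀ᶠ q : ℂ × (Fin (k - 1) → ℂ) in nhds 0, ∀ sq : ℂ, sq ≠ 0 → sq ^ 2 = q.1 →
      1 / sq =
        1 / Complex.log (deriv
            (preparedMap q.1 (bβ q.1 q.2) (bA q.1 q.2) (fun z => Q z q.1 q.2)) sq) -
        1 / Complex.log (deriv
            (preparedMap q.1 (bβ q.1 q.2) (bA q.1 q.2) (fun z => Q z q.1 q.2)) (-sq))) ∧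
  -- the formal invariant `a` is analytic and is given by the stated formula,
  -- independently of the choice of the square root `s` of `ε`
  AnalyticAt ℂ (fun q : ℂ × (Fin (k - 1) → ℂ) => a q.1 q.2)
    (0 : ℂ × (Fin (k - 1) → ℂ)) ∧
  (∀ᶠ q : ℂ × (Fin (k - 1) → ℂ) in nhds 0, ∀ sq : ℂ, sq ≠ 0 → sq ^ 2 = q.1 →
      a q.1 q.2 =
        1 / Complex.log (deriv
            (preparedMap q.1 (bβ q.1 q.2) (bA q.1 q.2) (fun z => Q z q.1 q.2)) sq) +
        1 / Complex.log (deriv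
            (preparedMap q.1 (bβ q.1 q.2) (bA q.1 q.2) (fun z => Q z q.1 q.2)) (-sq)))

open scoped BoundedContinuousFunction Topology ENNReal ContDiff

section Tools

attribute [local fun_prop] analyticAt_fst analyticAt_snd


variable {W : Type*} [NormedAddCommGroup W] [NormedSpace ℂ W]

noncomputable def nemSeries (p : FormalMultilinearSeries ℂ W ℂ) :
    FormalMultilinearSeries ℂ (ℝ →ᵇ W) (ℝ →ᵇ ℂ) := fun n =>
  MultilinearMap.mkContinuous
    { toFun := fun u => BoundedContinuousFunction.ofNormedAddCommGroup
        (fun t => p n (fun i => u i t))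
        ((p n).cont.comp (continuous_pi fun i => (u i).continuous))
        (‖p n‖ * ∏ i, ‖u i‖)
        (fun t => ((p n).le_opNorm _).trans (by
          gcongr with i; exact (u i).norm_coe_le_norm t))
      map_update_add' := by
        intro _ u i x y
        ext t
        have h : ∀ x : ℝ →ᵇ W, (fun j => (Function.update u i x j) t)
          = Function.update (fun j => u j t) i (x t) := by
          intro x; ext j; by_cases hj : j = i
          · subst hj; simp
          · simp [hj]
        simp [h]
      map_update_smul' := by
        intro _ u i c x
        ext t
        have h : ∀ x : ℝ →ᵇ W, (fun j => (Function.update u i x j) t)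
          = Function.update (fun j => u j t) i (x t) := by
          intro x; ext j; by_cases hj : j = i
          · subst hj; simp
          · simp [hj]
        simp [h] } ‖p n‖ (by
    intro u
    apply BoundedContinuousFunction.norm_ofNormedAddCommGroup_le
    · positivity
    · exact fun t => ((p n).le_opNorm _).trans (by
          gcongr with i; exact (u i).norm_coe_le_norm t))

lemma nemSeries_norm (p : FormalMultilinearSeries ℂ W ℂ) (n : ℕ) :
    ‖nemSeries p n‖ ≤ ‖p n‖ :=
  MultilinearMap.mkContinuous_norm_le _ (norm_nonneg _) _

lemma nemSeries_apply (p : FormalMultilinearSeries ℂ W ℂ) (n : ℕ) (u : Fin n → ℝ →ᵇ W) (t : ℝ) :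
    nemSeries p n u t = p n (fun i => u i t) := rfl

lemma nemytskii {K : W → ℂ} {p : FormalMultilinearSeries ℂ W ℂ} {r : ℝ≥0∞}
    (h : HasFPowerSeriesOnBall K p 0 r) :
    ∃ N : (ℝ →ᵇ W) → (ℝ →ᵇ ℂ), AnalyticOnNhd ℂ N (Metric.eball 0 r) ∧
      ∀ u ∈ Metric.eball (0 : ℝ →ᵇ W) r, ∀ t, N u t = K (u t) := by
  have hr : p.radius ≤ (nemSeries p).radius :=
    FormalMultilinearSeries.radius_le_of_le (fun n => nemSeries_norm p n)
  have hpos : 0 < (nemSeries p).radius := h.r_pos.trans_le (h.r_le.trans hr)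
  have H := ((nemSeries p).hasFPowerSeriesOnBall hpos).mono h.r_pos (h.r_le.trans hr)
  refine ⟨(nemSeries p).sum, H.analyticOnNhd, fun u hu t => ?_⟩
  have h1 := (H.hasSum hu).mapL (BoundedContinuousFunction.evalCLM ℂ t)
  have hut : u t ∈ Metric.eball (0 : W) r := by
    simp only [Metric.mem_eball, edist_zero_right] at hu ⊢
    refine lt_of_le_of_lt ?_ hu
    rw [← ofReal_norm, ← ofReal_norm]
    exact ENNReal.ofReal_le_ofReal (u.norm_coe_le_norm t)
  have h2 := h.hasSum hut
  simp only [zero_add, BoundedContinuousFunction.evalCLM_apply, nemSeries_apply] at h1 h2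
  exact h1.unique h2

variable {X : Type*} [NormedAddCommGroup X] [NormedSpace ℂ X]

/-- The circle as a bounded continuous function of the angle. -/
noncomputable def circ (ρ : ℝ) : ℝ →ᵇ ℂ :=
  BoundedContinuousFunction.ofNormedAddCommGroup (fun t => circleMap 0 ρ t)
    (continuous_circleMap 0 ρ) |ρ| (fun t => by simp)

lemma circ_apply (ρ t : ℝ) : circ ρ t = circleMap 0 ρ t := rfl

/-- Integration over `[0, 2π]` as a continuous linear functional. -/
noncomputable def intCLM : (ℝ →ᵇ ℂ) →L[ℂ] ℂ :=
  LinearMap.mkContinuous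
    { toFun := fun u => ∫ t in (0 : ℝ)..(2 * Real.pi), u t
      map_add' := fun u v => by
        simp only [BoundedContinuousFunction.coe_add, Pi.add_apply]
        exact intervalIntegral.integral_add (u.continuous.intervalIntegrable _ _)
          (v.continuous.intervalIntegrable _ _)
      map_smul' := fun c u => by
        simp only [BoundedContinuousFunction.coe_smul, RingHom.id_apply]
        exact intervalIntegral.integral_smul _ _ }
    |2 * Real.pi - 0| (fun u => by
      exact (intervalIntegral.norm_integral_le_of_norm_le_const
        (fun t _ => u.norm_coe_le_norm t)).trans_eq (mul_comm _ _))

lemma intCLM_apply (u : ℝ →ᵇ ℂ) : intCLM u = ∫ t in (0 : ℝ)..(2 * Real.pi), u t := rfl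

/-- Constant functions, as a continuous linear map. -/
noncomputable def constL (W : Type*) [NormedAddCommGroup W] [NormedSpace ℂ W] :
    W →L[ℂ] (ℝ →ᵇ W) :=
  LinearMap.mkContinuous
    { toFun := fun w => BoundedContinuousFunction.const ℝ w
      map_add' := fun u v => by ext t; rfl
      map_smul' := fun c u => by ext t; rfl }
    1 (fun u => by rw [one_mul]; exact BoundedContinuousFunction.norm_const_le u)

lemma constL_apply (w : W) (t : ℝ) : constL W w t = w := rfl

lemma kernel_int {K : ℂ × X → ℂ} (hK : AnalyticAt ℂ K 0) :
    ∃ ρ : ℝ, 0 < ρ ∧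
      (∀ᶠ η in 𝓝 (0 : X), DifferentiableOn ℂ (fun z => K (z, η)) (Metric.closedBall 0 ρ)) ∧
      ∀ b : ℝ →ᵇ ℂ, AnalyticAt ℂ (fun q : ℂ × X => ∫ t in (0 : ℝ)..(2 * Real.pi),
        K (circleMap 0 ρ t, q.2) * b t * ((circleMap 0 ρ t) ^ 2 - q.1)⁻¹) 0 := by
  obtain ⟨p, r, hp⟩ := hK
  obtain ⟨N, hN, hNe⟩ := nemytskii hp
  obtain ⟨ρ, hρ0, hρr⟩ : ∃ ρ : ℝ, 0 < ρ ∧ ENNReal.ofReal ρ < r := by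
    obtain ⟨a, ha, har⟩ := ENNReal.lt_iff_exists_nnreal_btwn.1 hp.r_pos
    exact ⟨a, by exact_mod_cast ha, by simpa using har⟩
  refine ⟨ρ, hρ0, ?_, ?_⟩
  · have h1 : ∀ᶠ η in 𝓝 (0 : X), η ∈ Metric.eball (0 : X) r := Metric.eball_mem_nhds _ hp.r_pos
    filter_upwards [h1] with η hη z hz
    have hm : (z, η) ∈ Metric.eball (0 : ℂ × X) r := by
      rw [Metric.mem_eball] at hη ⊢
      rw [Prod.edist_eq]
      refine max_lt ?_ hη
      simp only [Prod.fst_zero, edist_zero_right]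
      refine lt_of_le_of_lt ?_ hρr
      rw [← ofReal_norm]
      exact ENNReal.ofReal_le_ofReal (by simpa using hz)
    have h2 := (hp.analyticOnNhd _ hm).differentiableAt
    exact (DifferentiableAt.comp z (f := fun z : ℂ => (z, η)) h2
      (by fun_prop)).differentiableWithinAt
  · intro b
    -- the path of substitutions
    let u0 : ℝ →ᵇ ℂ × X := BoundedContinuousFunction.ofNormedAddCommGroup
      (fun t => (circleMap 0 ρ t, (0 : X)))
      ((continuous_circleMap 0 ρ).prodMk continuous_const) ρ (fun t => by
        simp [Prod.norm_def, abs_of_pos hρ0, hρ0.le])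
    let U : ℂ × X → (ℝ →ᵇ ℂ × X) := fun q => u0 + constL (ℂ × X) (0, q.2)
    have hU : AnalyticAt ℂ U 0 := by
      apply analyticAt_const.add
      exact ((constL (ℂ × X)).comp ((ContinuousLinearMap.inr ℂ ℂ X).comp
        (ContinuousLinearMap.snd ℂ ℂ X))).analyticAt 0
    have hU0 : U 0 = u0 := by
      ext t <;> simp [U, constL_apply]
    have hu0 : u0 ∈ Metric.eball (0 : ℝ →ᵇ ℂ × X) r := by
      simp only [Metric.mem_eball, edist_zero_right]
      refine lt_of_le_of_lt ?_ hρr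
      rw [← ofReal_norm]
      exact ENNReal.ofReal_le_ofReal
        (BoundedContinuousFunction.norm_ofNormedAddCommGroup_le _ hρ0.le _)
    have hNU : AnalyticAt ℂ (fun q => N (U q)) 0 :=
      AnalyticAt.comp (hU0 ▸ hN u0 hu0) hU
    -- the kernel
    let c2 : ℝ →ᵇ ℂ := circ ρ * circ ρ
    have hci : ∀ t, circleMap 0 ρ t ≠ 0 := fun t => circleMap_ne_center hρ0.ne'
    let ci : ℝ →ᵇ ℂ := BoundedContinuousFunction.ofNormedAddCommGroup
      (fun t => (circleMap 0 ρ t)⁻¹)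
      ((continuous_circleMap 0 ρ).inv₀ hci) ρ⁻¹ (fun t => by simp [abs_of_pos hρ0])
    have hc : c2 * (ci * ci) = 1 := by
      ext t
      have := hci t
      simp [c2, ci, circ_apply]
      field_simp
    let cu : (ℝ →ᵇ ℂ)ˣ := ⟨c2, ci * ci, hc, by rw [mul_comm]; exact hc⟩
    let S : ℂ × X → (ℝ →ᵇ ℂ) := fun q => c2 - constL ℂ q.1
    have hS : AnalyticAt ℂ S 0 := by
      apply analyticAt_const.sub
      exact ((constL ℂ).comp (ContinuousLinearMap.fst ℂ ℂ X)).analyticAt 0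
    have hS0 : S 0 = cu := by
      simp [S, cu]
    have hSi : AnalyticAt ℂ (fun q => Ring.inverse (S q)) 0 := by
      refine AnalyticAt.comp (g := Ring.inverse) ?_ hS
      rw [hS0]
      exact analyticAt_inverse cu
    have hT : AnalyticAt ℂ (fun q => intCLM (N (U q) * b * Ring.inverse (S q))) 0 :=
      (intCLM.analyticAt _).comp ((hNU.mul analyticAt_const).mul hSi)
    refine hT.congr ?_
    have e1 : ∀ᶠ q in 𝓝 (0 : ℂ × X), U q ∈ Metric.eball (0 : ℝ →ᵇ ℂ × X) r :=
      hU.continuousAt.eventually (hU0 ▸ Metric.isOpen_eball.mem_nhds hu0)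
    have e2 : ∀ᶠ q in 𝓝 (0 : ℂ × X), IsUnit (S q) :=
      hS.continuousAt.eventually (hS0 ▸ Units.nhds cu)
    filter_upwards [e1, e2] with q h1 h2
    rw [intCLM_apply]
    congr 1
    ext t
    have h3 : Ring.inverse (S q) t * S q t = 1 := by
      rw [← BoundedContinuousFunction.mul_apply, Ring.inverse_mul_cancel _ h2]; rfl
    have h4 : S q t = circleMap 0 ρ t ^ 2 - q.1 := by
      simp [S, c2, circ_apply, constL_apply, sq]
    have h5 : U q t = (circleMap 0 ρ t, q.2) := by
      ext <;> simp [U, u0, constL_apply]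
    rw [BoundedContinuousFunction.mul_apply, BoundedContinuousFunction.mul_apply, hNe _ h1, h5,
      eq_inv_of_mul_eq_one_left h3, h4]

lemma parts_aux {K : ℂ × X → ℂ} (hK : AnalyticAt ℂ K 0) :
    ∃ k0 k1 k2 : ℂ × X → ℂ, AnalyticAt ℂ k0 0 ∧ AnalyticAt ℂ k1 0 ∧ AnalyticAt ℂ k2 0 ∧
      (∀ᶠ p in 𝓝 (0 : ℂ × X), K p = k0 (p.1 ^ 2, p.2) + p.1 * k1 (p.1 ^ 2, p.2)) ∧
      (∀ᶠ p in 𝓝 (0 : ℂ × X),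
        K p = K (0, p.2) + p.1 * (k1 (p.1 ^ 2, p.2) + p.1 * k2 (p.1 ^ 2, p.2))) := by
  obtain ⟨ρ, hρ, hd, hJ⟩ := kernel_int hK
  have hpi : (2 * (Real.pi : ℂ)) ≠ 0 := by simp [Real.pi_ne_zero]
  let b2 : ℝ →ᵇ ℂ := constL ℂ (2 * (Real.pi : ℂ))⁻¹
  refine ⟨_, _, _, hJ (circ ρ * circ ρ * b2), hJ (circ ρ * b2), hJ b2, ?_⟩
  have e1 : ∀ᶠ p in 𝓝 (0 : ℂ × X),
      DifferentiableOn ℂ (fun z => K (z, p.2)) (Metric.closedBall 0 ρ) :=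
    (continuous_snd.tendsto' (0 : ℂ × X) 0 rfl).eventually hd
  have e2 : ∀ᶠ p in 𝓝 (0 : ℂ × X), p.1 ∈ Metric.ball (0 : ℂ) ρ :=
    (continuous_fst.tendsto' (0 : ℂ × X) 0 rfl).eventually (Metric.ball_mem_nhds _ hρ)
  rw [← eventually_and]
  filter_upwards [e1, e2] with p h1 h2
  have hcont : Continuous fun t : ℝ => K (circleMap 0 ρ t, p.2) := by
    have := h1.continuousOn.comp_continuous (continuous_circleMap 0 ρ)
      (fun t => circleMap_mem_closedBall 0 hρ.le t)
    exact this
  have hne : ∀ t : ℝ, circleMap 0 ρ t - p.1 ≠ 0 := by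
    intro t h
    have h3 : circleMap 0 ρ t = p.1 := sub_eq_zero.1 h
    rw [← h3] at h2
    simp [abs_of_pos hρ] at h2
  have hne2 : ∀ t : ℝ, circleMap 0 ρ t + p.1 ≠ 0 := by
    intro t h
    have h3 : circleMap 0 ρ t = - p.1 := eq_neg_of_add_eq_zero_left h
    have h4 : ‖circleMap 0 ρ t‖ < ρ := by rw [h3]; simpa using h2
    simp [abs_of_pos hρ] at h4
  have hne3 : ∀ t : ℝ, circleMap 0 ρ t ^ 2 - p.1 ^ 2 ≠ 0 := by
    intro t
    rw [sq_sub_sq]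
    exact mul_ne_zero (hne2 t) (hne t)
  have hci : ∀ t, circleMap 0 ρ t ≠ 0 := fun t => circleMap_ne_center hρ.ne'
  have key : ∀ w : ℂ, w ∈ Metric.ball (0 : ℂ) ρ → K (w, p.2) = ∫ t in (0 : ℝ)..(2 * Real.pi),
      K (circleMap 0 ρ t, p.2) * circleMap 0 ρ t * (2 * (Real.pi : ℂ))⁻¹ *
        (circleMap 0 ρ t - w)⁻¹ := by
    intro w hw
    have := h1.circleIntegral_sub_inv_smul hw
    rw [circleIntegral] at this
    have h5 : K (w, p.2) = (2 * Real.pi * I)⁻¹ * ((2 * Real.pi * I) • K (w, p.2)) := by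
      rw [smul_eq_mul, inv_mul_cancel_left₀]
      exact mul_ne_zero hpi I_ne_zero
    rw [h5, ← this, ← intervalIntegral.integral_const_mul]
    congr 1
    ext t
    simp only [deriv_circleMap, smul_eq_mul]
    have := I_ne_zero
    field_simp
  have cK : Continuous fun t : ℝ => (circleMap 0 ρ t ^ 2 - p.1 ^ 2)⁻¹ :=
    (((continuous_circleMap 0 ρ).pow 2).sub continuous_const).inv₀ hne3
  have ci : ∀ b : ℝ →ᵇ ℂ, IntervalIntegrable (fun t : ℝ =>
      K (circleMap 0 ρ t, p.2) * b t * (circleMap 0 ρ t ^ 2 - p.1 ^ 2)⁻¹)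
      MeasureTheory.volume 0 (2 * Real.pi) := fun b =>
    ((hcont.mul b.continuous).mul cK).intervalIntegrable _ _
  constructor
  · rw [← intervalIntegral.integral_const_mul, ← intervalIntegral.integral_add (ci _)
      ((ci _).const_mul _)]
    refine (key p.1 h2).trans ?_
    congr 1
    ext t
    simp only [BoundedContinuousFunction.mul_apply, circ_apply, b2, constL_apply]
    have := hne3 t
    have := hne t
    field_simp
    ring
  · rw [← intervalIntegral.integral_const_mul, ← intervalIntegral.integral_add (ci _)
      ((ci _).const_mul _), ← intervalIntegral.integral_const_mul]
    refine (key p.1 h2).trans ?_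
    rw [key 0 (by simpa using hρ), ← intervalIntegral.integral_add]
    · congr 1
      ext t
      simp only [BoundedContinuousFunction.mul_apply, circ_apply, b2, constL_apply]
      have := hne3 t
      have := hne t
      have := hci t
      simp only [sub_zero]
      field_simp
      ring
    · refine (((hcont.mul (continuous_circleMap 0 ρ)).mul continuous_const).mul
        (Continuous.inv₀ ?_ ?_)).intervalIntegrable _ _
      · exact (continuous_circleMap 0 ρ).sub continuous_const
      · simpa using hci
    · exact (((ci _).add ((ci _).const_mul _))).const_mul _

lemma even_odd {K : ℂ × X → ℂ} (hK : AnalyticAt ℂ K 0) :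
    ∃ k0 k1 : ℂ × X → ℂ, AnalyticAt ℂ k0 0 ∧ AnalyticAt ℂ k1 0 ∧
      (∀ᶠ p in 𝓝 (0 : ℂ × X), K p = k0 (p.1 ^ 2, p.2) + p.1 * k1 (p.1 ^ 2, p.2)) := by
  obtain ⟨k0, k1, k2, h0, h1, _, h, _⟩ := parts_aux hK
  exact ⟨k0, k1, h0, h1, h⟩

lemma div_lemma {K : ℂ × X → ℂ} (hK : AnalyticAt ℂ K 0) :
    ∃ G : ℂ × X → ℂ, AnalyticAt ℂ G 0 ∧
      (∀ᶠ p in 𝓝 (0 : ℂ × X), K p = K (0, p.2) + p.1 * G p) := by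
  obtain ⟨k0, k1, k2, _, h1, h2, _, h⟩ := parts_aux hK
  have hs : AnalyticAt ℂ (fun p : ℂ × X => (p.1 ^ 2, p.2)) 0 := by fun_prop
  have h00 : ((0 : ℂ × X).1 ^ 2, (0 : ℂ × X).2) = 0 := by simp
  refine ⟨fun p => k1 (p.1 ^ 2, p.2) + p.1 * k2 (p.1 ^ 2, p.2), ?_, h⟩
  refine AnalyticAt.add ?_ (AnalyticAt.mul (by fun_prop) ?_)
  · exact AnalyticAt.comp (f := fun p : ℂ × X => (p.1 ^ 2, p.2)) (by rw [h00]; exact h1) hs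
  · exact AnalyticAt.comp (f := fun p : ℂ × X => (p.1 ^ 2, p.2)) (by rw [h00]; exact h2) hs

/-- Divided differences in the first variable. -/
lemma divdiff {K : ℂ × X → ℂ} (hK : AnalyticAt ℂ K 0) :
    ∃ D : ℂ × (ℂ × X) → ℂ, AnalyticAt ℂ D 0 ∧
      (∀ᶠ p in 𝓝 (0 : ℂ × (ℂ × X)), K (p.2.1 + p.1, p.2.2) = K p.2 + p.1 * D p) := by
  have hL : AnalyticAt ℂ (fun p : ℂ × (ℂ × X) => (p.2.1 + p.1, p.2.2)) 0 := by fun_prop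
  have h00 : ((0 : ℂ × (ℂ × X)).2.1 + (0 : ℂ × (ℂ × X)).1, (0 : ℂ × (ℂ × X)).2.2) = 0 := by simp
  obtain ⟨D, hD, h⟩ := div_lemma (K := fun p : ℂ × (ℂ × X) => K (p.2.1 + p.1, p.2.2))
    (AnalyticAt.comp (f := fun p : ℂ × (ℂ × X) => (p.2.1 + p.1, p.2.2))
      (by rw [h00]; exact hK) hL)
  refine ⟨D, hD, ?_⟩
  filter_upwards [h] with p hp
  simpa using hp

lemma hasDerivAt_of_mul {F G : ℂ → ℂ} {a : ℂ} (hG : ContinuousAt G 0)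
    (h : ∀ᶠ z in 𝓝 0, F z = a + z * G z) : HasDerivAt F (G 0) 0 := by
  have h0 : F 0 = a := by simpa using h.self_of_nhds
  rw [hasDerivAt_iff_tendsto_slope]
  have hG' : Tendsto G (𝓝[≠] 0) (𝓝 (G 0)) := hG.tendsto.mono_left nhdsWithin_le_nhds
  refine hG'.congr' ?_
  filter_upwards [h.filter_mono nhdsWithin_le_nhds, self_mem_nhdsWithin] with z hz hz0
  have hz0 : z ≠ 0 := hz0
  rw [slope_def_field, hz, h0]
  field_simp
  ring

lemma ift {A B : Type*} [NormedAddCommGroup A] [NormedSpace ℂ A] [CompleteSpace A]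
    [NormedAddCommGroup B] [NormedSpace ℂ B] [CompleteSpace B] {F : A → B}
    (hF : AnalyticAt ℂ F 0) (F' : A ≃L[ℂ] B) (hF' : HasFDerivAt F (F' : A →L[ℂ] B) 0)
    (h0 : F 0 = 0) :
    ∃ G : B → A, AnalyticAt ℂ G 0 ∧ G 0 = 0 ∧ (∀ᶠ x in 𝓝 0, G (F x) = x) ∧
      (∀ᶠ y in 𝓝 0, F (G y) = y) := by
  have hc : ContDiffAt ℂ ω F 0 := hF.contDiffAt
  have hn : (ω : WithTop ℕ∞) ≠ 0 := by simp
  have hs : HasStrictFDerivAt F (F' : A →L[ℂ] B) 0 := hc.hasStrictFDerivAt' hF' hn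
  have h1 : ∀ᶠ x in 𝓝 0, hc.localInverse hF' hn (F x) = x := hs.eventually_left_inverse
  have h2 : ∀ᶠ y in 𝓝 (F 0), F (hc.localInverse hF' hn y) = y := hs.eventually_right_inverse
  have h3 := (hc.to_localInverse hF' hn).analyticAt
  rw [h0] at h2 h3
  refine ⟨hc.localInverse hF' hn, h3, ?_, h1, h2⟩
  have := h1.self_of_nhds
  rwa [h0] at this

lemma inv_param [CompleteSpace X] {ψ : ℂ × X → ℂ} (hψ : AnalyticAt ℂ ψ 0) (h0 : ψ 0 = 0)
    (hd : deriv (fun z => ψ (z, 0)) 0 ≠ 0) :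
    ∃ χ : ℂ × X → ℂ, AnalyticAt ℂ χ 0 ∧ χ 0 = 0 ∧ (∀ᶠ p in 𝓝 0, χ (ψ p, p.2) = p.1) ∧
      (∀ᶠ q in 𝓝 0, ψ (χ q, q.2) = q.1) := by
  have hF := hψ.differentiableAt.hasFDerivAt
  set L := fderiv ℂ ψ 0 with hL
  have ha : deriv (fun z => ψ (z, 0)) 0 = L (1, 0) := by
    have h1 : HasDerivAt (fun z : ℂ => (z, (0 : X))) (1, 0) 0 :=
      (hasDerivAt_id (0 : ℂ)).prodMk (hasDerivAt_const _ _)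
    exact (HasFDerivAt.comp_hasDerivAt (f := fun z : ℂ => (z, (0 : X))) (0 : ℂ) hF h1).deriv
  rw [ha] at hd
  set a := L (1, 0)
  have hLs : ∀ p : ℂ × X, L p = p.1 * a + L (0, p.2) := by
    intro p
    have : p = p.1 • ((1 : ℂ), (0 : X)) + (0, p.2) := by ext <;> simp
    conv_lhs => rw [this]
    rw [map_add, map_smul]; rfl
  let F' : (ℂ × X) ≃L[ℂ] (ℂ × X) := ContinuousLinearEquiv.equivOfInverse
    (L.prod (ContinuousLinearMap.snd ℂ ℂ X))
    ((a⁻¹ • (ContinuousLinearMap.fst ℂ ℂ X - (L.comp (ContinuousLinearMap.inr ℂ ℂ X)).comp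
      (ContinuousLinearMap.snd ℂ ℂ X))).prod (ContinuousLinearMap.snd ℂ ℂ X))
    (by intro p; ext
        · simp; rw [hLs p]; field_simp; ring
        · simp)
    (by intro p; ext
        · simp; rw [hLs]; simp; field_simp; ring
        · simp)
  obtain ⟨G, hG, hG0, h1, h2⟩ := ift (F := fun p : ℂ × X => (ψ p, p.2))
    (hψ.prod analyticAt_snd) F' (hF.prodMk hasFDerivAt_snd) (by simp [h0])
  refine ⟨fun q => (G q).1, analyticAt_fst.comp hG, by simp [hG0], ?_, ?_⟩
  · filter_upwards [h1] with p hp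
    rw [hp]
  · filter_upwards [h2] with q hq
    have e1 := congrArg Prod.fst hq
    have e2 := congrArg Prod.snd hq
    simp only at e1 e2
    rw [← e2]
    exact e1

set_option linter.unusedSectionVars false in
lemma deriv_slice {F G : ℂ × X → ℂ} (hG : ContinuousAt G 0) {a : ℂ}
    (h : ∀ᶠ p in 𝓝 (0 : ℂ × X), F p = a + p.1 * G p) :
    HasDerivAt (fun z => F (z, 0)) (G 0) 0 := by
  have ht : Tendsto (fun z : ℂ => (z, (0 : X))) (𝓝 0) (𝓝 0) :=
    Continuous.tendsto' (by fun_prop) _ _ rfl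
  exact hasDerivAt_of_mul (G := fun z => G (z, 0)) (a := a) (Tendsto.comp hG ht) (ht.eventually h)

lemma lemmaB {H : ℂ × X → ℂ} (hH : AnalyticAt ℂ H 0) (hH0 : H 0 ≠ 0) :
    ∃ n o : ℂ × X → ℂ, AnalyticAt ℂ n 0 ∧ AnalyticAt ℂ o 0 ∧ n 0 * H 0 = 1 ∧
      ∀ᶠ p in 𝓝 (0 : ℂ × X), p.1 ≠ 0 →
        1 / Complex.log (1 + 2 * p.1 * H p) - 1 / Complex.log (1 + 2 * (-p.1) * H (-p.1, p.2))
          = n (p.1 ^ 2, p.2) / p.1 ∧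
        1 / Complex.log (1 + 2 * p.1 * H p) + 1 / Complex.log (1 + 2 * (-p.1) * H (-p.1, p.2))
          = o (p.1 ^ 2, p.2) := by
  have hF : AnalyticAt ℂ (fun p : ℂ × X => Complex.log (1 + 2 * p.1 * H p)) 0 := by
    refine AnalyticAt.clog (by fun_prop) ?_
    simp
  obtain ⟨M, hM, hFM⟩ := div_lemma hF
  have hFM' : ∀ᶠ p in 𝓝 (0 : ℂ × X), Complex.log (1 + 2 * p.1 * H p) = 0 + p.1 * M p := by
    filter_upwards [hFM] with p hp
    simpa using hp
  have hM0 : M 0 = 2 * H 0 := by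
    have d1 := deriv_slice hM.continuousAt hFM'
    have d2 : HasDerivAt (fun z : ℂ => 1 + 2 * z * H (z, 0)) (2 * H 0) 0 := by
      refine hasDerivAt_of_mul (F := fun z : ℂ => 1 + 2 * z * H (z, 0))
        (G := fun z => 2 * H (z, 0)) (a := 1) ?_ (Eventually.of_forall fun z => by ring)
      have : ContinuousAt (fun z : ℂ => H (z, (0 : X))) 0 :=
        ContinuousAt.comp (f := fun z : ℂ => (z, (0 : X))) hH.continuousAt (by fun_prop)
      exact this.const_mul 2
    have d3 := d2.clog (by simp)
    have := d1.unique d3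
    simpa using this
  have hM0' : M 0 ≠ 0 := by rw [hM0]; exact mul_ne_zero two_ne_zero hH0
  obtain ⟨k0, k1, hk0, hk1, hk⟩ := even_odd (hM.inv hM0')
  refine ⟨fun p => 2 * k0 p, fun p => 2 * k1 p, analyticAt_const.mul hk0, analyticAt_const.mul hk1,
    ?_, ?_⟩
  · have := hk.self_of_nhds
    simp only [Pi.inv_apply, hM0, Prod.fst_zero, zero_mul, add_zero] at this
    have h00 : (((0 : ℂ) ^ 2, (0 : ℂ × X).2)) = (0 : ℂ × X) := by simp
    rw [h00] at this
    show 2 * k0 0 * H 0 = 1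
    rw [← this]
    field_simp
  · have ht : Tendsto (fun p : ℂ × X => (-p.1, p.2)) (𝓝 0) (𝓝 0) :=
      Continuous.tendsto' (by fun_prop) _ _ (by simp)
    have hMne : ∀ᶠ p in 𝓝 (0 : ℂ × X), M p ≠ 0 := hM.continuousAt.eventually_ne hM0'
    filter_upwards [hFM', ht.eventually hFM', hk, ht.eventually hk] with p h1 h2 h3 h4 hp
    rw [h1, h2]
    simp only [Pi.inv_apply, neg_sq] at h3 h4
    rw [zero_add, zero_add, one_div, one_div, mul_inv, mul_inv, h3, h4]
    constructor <;> field_simp <;> ring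


lemma tendsto_zero_of {A B : Type*} [NormedAddCommGroup A] [NormedSpace ℂ A]
    [NormedAddCommGroup B] [NormedSpace ℂ B] {F : A → B} (h : AnalyticAt ℂ F 0) (h0 : F 0 = 0) :
    Tendsto F (𝓝 0) (𝓝 0) := by
  have := h.continuousAt.tendsto
  rwa [h0] at this

lemma lemmaA [CompleteSpace X] {f : ℂ × X → ℂ} (hf : AnalyticAt ℂ f 0) (hf0 : f 0 = 0)
    (h1 : deriv (fun z => f (z, 0)) 0 = 1)
    (h2 : deriv (deriv (fun z => f (z, 0))) 0 ≠ 0) :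
    ∃ (ψ : ℂ × X → ℂ) (c : X → ℂ) (H : ℂ × X → ℂ), AnalyticAt ℂ ψ 0 ∧ AnalyticAt ℂ c 0 ∧
      AnalyticAt ℂ H 0 ∧ ψ 0 = 0 ∧ deriv (fun z => ψ (z, 0)) 0 ≠ 0 ∧ c 0 = 0 ∧
      (∀ v, fderiv ℂ c 0 v = - fderiv ℂ f 0 (0, v)) ∧ H 0 ≠ 0 ∧
      ∀ᶠ p in 𝓝 (0 : ℂ × X), ψ (f p, p.2) = ψ p + (ψ p ^ 2 - c p.2) * H (ψ p, p.2) := by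
  -- the displacement function and its divided difference
  let g : ℂ × X → ℂ := fun p => f p - p.1
  have hg : AnalyticAt ℂ g 0 := hf.sub analyticAt_fst
  have hg0 : g 0 = 0 := by simp [g, hf0]
  obtain ⟨D, hD, hgD⟩ := divdiff hg
  -- the derivative of `g` in `z`
  let g1 : ℂ × X → ℂ := fun p => D (0, p)
  have hg1 : AnalyticAt ℂ g1 0 :=
    AnalyticAt.comp_of_eq (f := fun p : ℂ × X => ((0 : ℂ), p)) hD (by fun_prop) rfl
  have hcD : ∀ᶠ p in 𝓝 (0 : ℂ × (ℂ × X)), AnalyticAt ℂ D p := hD.eventually_analyticAt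
  have hderiv : ∀ᶠ z in 𝓝 (0 : ℂ), deriv (fun z => f (z, 0)) z = 1 + g1 (z, 0) := by
    have ht : Tendsto (fun z : ℂ => ((0 : ℂ), (z, (0 : X)))) (𝓝 0) (𝓝 0) :=
      Continuous.tendsto' (by fun_prop) _ _ rfl
    filter_upwards [ht.eventually hgD.eventually_nhds, ht.eventually hcD] with z hz hz2
    have ht2 : Tendsto (fun h : ℂ => (h, (z, (0 : X)))) (𝓝 0) (𝓝 (0, (z, 0))) :=
      Continuous.tendsto' (by fun_prop) _ _ rfl
    have d1 : HasDerivAt (fun h : ℂ => g (z + h, 0)) (g1 (z, 0)) 0 :=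
      hasDerivAt_of_mul (G := fun h : ℂ => D (h, (z, 0))) (a := g (z, 0))
        (Tendsto.comp hz2.continuousAt ht2) (ht2.eventually hz)
    have d2 : HasDerivAt (fun h : ℂ => f (z + h, 0)) (g1 (z, 0) + 1) 0 := by
      have := d1.add ((hasDerivAt_id (0 : ℂ)).const_add z)
      refine this.congr_of_eventuallyEq (Eventually.of_forall fun h => ?_)
      simp [g]
    have d3 : HasDerivAt (fun w : ℂ => f (w, 0)) (g1 (z, 0) + 1) z := by
      have d4 : HasDerivAt (fun h : ℂ => f (z + h, 0)) (g1 (z, 0) + 1) (z - z) := by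
        rwa [sub_self]
      have := d4.comp_sub_const z z
      simpa using this
    rw [d3.deriv, add_comm]
  have hg10 : g1 0 = 0 := by
    have := hderiv.self_of_nhds
    rw [h1] at this
    have h3 : g1 (0, 0) = 0 := by simpa using this
    exact h3
  have hg1d : deriv (fun z => g1 (z, 0)) 0 ≠ 0 := by
    have e : deriv (fun z => f (z, 0)) =ᶠ[𝓝 0] fun z => 1 + g1 (z, 0) := hderiv
    rw [e.deriv_eq, deriv_const_add] at h2
    exact h2
  -- the critical point
  obtain ⟨χ1, hχ1, hχ10, -, hχ1r⟩ := inv_param hg1 hg10 hg1d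
  let m : X → ℂ := fun η => χ1 (0, η)
  have hm : AnalyticAt ℂ m 0 :=
    AnalyticAt.comp_of_eq (f := fun η : X => ((0 : ℂ), η)) hχ1 (by fun_prop) rfl
  have hm0 : m 0 = 0 := hχ10
  have hmcrit : ∀ᶠ η in 𝓝 (0 : X), D (0, (m η, η)) = 0 := by
    have ht : Tendsto (fun η : X => ((0 : ℂ), η)) (𝓝 0) (𝓝 0) :=
      Continuous.tendsto' (by fun_prop) _ _ rfl
    exact ht.eventually hχ1r
  have hmap : AnalyticAt ℂ (fun p : ℂ × X => (p.1, (m p.2, p.2))) 0 :=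
    analyticAt_fst.prod ((AnalyticAt.comp_of_eq hm analyticAt_snd rfl).prod analyticAt_snd)
  have hmap0 : (fun p : ℂ × X => (p.1, (m p.2, p.2))) 0 = 0 := by simp [hm0]
  have hDm : AnalyticAt ℂ (fun p : ℂ × X => D (p.1, (m p.2, p.2))) 0 :=
    AnalyticAt.comp_of_eq (f := fun p : ℂ × X => (p.1, (m p.2, p.2))) hD hmap hmap0
  obtain ⟨u, hu, hDu⟩ := div_lemma hDm
  have tsnd : Tendsto (fun p : ℂ × X => p.2) (𝓝 0) (𝓝 0) := continuous_snd.tendsto' _ _ rfl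
  -- Taylor expansion at the critical point
  have hTay : ∀ᶠ p in 𝓝 (0 : ℂ × X), g (m p.2 + p.1, p.2) = g (m p.2, p.2) + p.1 ^ 2 * u p := by
    have ht : Tendsto (fun p : ℂ × X => (p.1, (m p.2, p.2))) (𝓝 0) (𝓝 0) :=
      tendsto_zero_of hmap hmap0
    filter_upwards [ht.eventually hgD, hDu, tsnd.eventually hmcrit] with p e1 e2 e3
    rw [e1, e2, e3]
    ring
  -- `u 0 ≠ 0`
  have hu0 : u 0 ≠ 0 := by
    intro hu0
    have hcu : AnalyticAt ℂ (fun z : ℂ => u (z, 0)) 0 :=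
      AnalyticAt.comp_of_eq (f := fun z : ℂ => (z, (0 : X))) hu (by fun_prop) rfl
    have ht : Tendsto (fun z : ℂ => (z, (0 : X))) (𝓝 0) (𝓝 0) :=
      Continuous.tendsto' (by fun_prop) _ _ rfl
    have e1 : (fun z : ℂ => f (z, 0)) =ᶠ[𝓝 0] fun z => z + z ^ 2 * u (z, 0) := by
      filter_upwards [ht.eventually hTay] with z hz
      have hgz : g (0, 0) = 0 := hg0
      simp only [hm0, zero_add, hgz] at hz
      simp only [g] at hz
      linear_combination hz
    have e2 : deriv (fun z : ℂ => f (z, 0)) =ᶠ[𝓝 0]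
        fun z => 1 + z * (2 * u (z, 0) + z * deriv (fun z => u (z, 0)) z) := by
      refine e1.deriv.trans ?_
      filter_upwards [hcu.eventually_analyticAt] with z hz
      have d := (hasDerivAt_id z).add ((hasDerivAt_pow 2 z).mul hz.differentiableAt.hasDerivAt)
      refine d.deriv.trans ?_
      push_cast
      ring
    have d3 := hasDerivAt_of_mul (G := fun z => 2 * u (z, 0) + z * deriv (fun z => u (z, 0)) z)
      ((hcu.continuousAt.const_mul 2).add (continuousAt_id.mul hcu.deriv.continuousAt)) e2
    apply h2
    rw [d3.deriv]
    have : u (0, 0) = 0 := hu0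
    simp [this]
  -- square root of `u`
  let w : ℂ × X → ℂ := fun p => p.1 - m p.2
  have hw : AnalyticAt ℂ w 0 := analyticAt_fst.sub (AnalyticAt.comp_of_eq (g := m) hm analyticAt_snd rfl)
  have hw0 : w 0 = 0 := by simp [w, hm0]
  let us : ℂ × X → ℂ := fun p => u (w p, p.2)
  have hus : AnalyticAt ℂ us 0 :=
    AnalyticAt.comp_of_eq (f := fun p : ℂ × X => (w p, p.2)) hu (hw.prod analyticAt_snd)
      (by simp [hw0])
  have hus0 : us 0 = u 0 := by
    simp only [us, hw0]; rfl
  obtain ⟨b, hb⟩ : ∃ b : ℂ, b ^ 2 = u 0 := IsAlgClosed.exists_pow_nat_eq (u 0) two_pos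
  have hb0 : b ≠ 0 := by rintro rfl; exact hu0 (by rw [← hb]; simp)
  let r : ℂ × X → ℂ := fun p => b * Complex.exp (Complex.log (us p / u 0) / 2)
  have hr : AnalyticAt ℂ r 0 := by
    refine analyticAt_const.mul (AnalyticAt.cexp ?_)
    refine AnalyticAt.div (AnalyticAt.clog ?_ ?_) analyticAt_const two_ne_zero
    · exact hus.div analyticAt_const hu0
    · rw [hus0, div_self hu0]; simp
  have hr0 : r 0 = b := by simp [r, hus0, div_self hu0]
  have hrsq : ∀ᶠ p in 𝓝 (0 : ℂ × X), r p ^ 2 = us p := by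
    have : ∀ᶠ p in 𝓝 (0 : ℂ × X), us p ≠ 0 :=
      hus.continuousAt.eventually_ne (by rwa [hus0])
    filter_upwards [this] with p hp
    simp only [r]
    rw [mul_pow, ← Complex.exp_nat_mul, hb]
    have : ((2 : ℕ) : ℂ) * (Complex.log (us p / u 0) / 2) = Complex.log (us p / u 0) := by
      push_cast; ring
    rw [this, Complex.exp_log (div_ne_zero hp hu0)]
    field_simp
  -- the Morse coordinate
  let ψ : ℂ × X → ℂ := fun p => w p * r p
  let c : X → ℂ := fun η => - g (m η, η)
  have hψ : AnalyticAt ℂ ψ 0 := hw.mul hr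
  have hψ0 : ψ 0 = 0 := by simp [ψ, hw0]
  have hmid : AnalyticAt ℂ (fun η : X => (m η, η)) 0 := hm.prod analyticAt_id
  have hmid0 : (m 0, (0 : X)) = 0 := by simp [hm0]
  have hc : AnalyticAt ℂ c 0 :=
    (AnalyticAt.comp_of_eq (f := fun η : X => (m η, η)) hg hmid hmid0).neg
  have hgψ : ∀ᶠ p in 𝓝 (0 : ℂ × X), g p = ψ p ^ 2 - c p.2 := by
    have ht : Tendsto (fun p : ℂ × X => (w p, p.2)) (𝓝 0) (𝓝 0) :=
      tendsto_zero_of (hw.prod analyticAt_snd) (by simp [hw0])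
    filter_upwards [ht.eventually hTay, hrsq] with p e1 e2
    simp only [ψ, c, mul_pow, e2]
    have : m p.2 + w p = p.1 := by simp [w]
    simp only [this] at e1
    rw [e1]
    simp [us]
    ring
  have tz : Tendsto (fun z : ℂ => (z, (0 : X))) (𝓝 0) (𝓝 0) :=
    Continuous.tendsto' (by fun_prop) _ _ rfl
  have hψd : HasDerivAt (fun z => ψ (z, 0)) b 0 := by
    have := hasDerivAt_of_mul (F := fun z => ψ (z, 0)) (G := fun z => r (z, 0)) (a := 0)
      (Tendsto.comp (g := r) hr.continuousAt tz) (Eventually.of_forall fun z => by simp [ψ, w, hm0])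
    have e : r (0, 0) = b := hr0
    rwa [e] at this
  obtain ⟨H0, hH0, hψH⟩ := divdiff hψ
  have hH0b : H0 0 = b := by
    have ht : Tendsto (fun z : ℂ => (z, (0 : ℂ × X))) (𝓝 0) (𝓝 0) :=
      Continuous.tendsto' (by fun_prop) _ _ rfl
    have := hasDerivAt_of_mul (F := fun z => ψ (z, 0)) (G := fun z => H0 (z, 0)) (a := ψ 0)
      (Tendsto.comp hH0.continuousAt ht) (by
        filter_upwards [ht.eventually hψH] with z hz
        simpa using hz)
    exact this.unique hψd
  obtain ⟨χ, hχ, hχ0, hχl, hχr⟩ := inv_param hψ hψ0 (by rw [hψd.deriv]; exact hb0)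
  have hχs : AnalyticAt ℂ (fun q : ℂ × X => (χ q, q.2)) 0 := hχ.prod analyticAt_snd
  have hχs0 : (χ 0, (0 : ℂ × X).2) = 0 := by simp [hχ0]
  have hgχ : AnalyticAt ℂ (fun q : ℂ × X => g (χ q, q.2)) 0 :=
    AnalyticAt.comp_of_eq (g := g) (f := fun q : ℂ × X => (χ q, q.2)) hg hχs hχs0
  refine ⟨ψ, c, fun q => H0 (g (χ q, q.2), (χ q, q.2)), hψ, hc, ?_, hψ0, ?_, ?_, ?_, ?_, ?_⟩
  · exact AnalyticAt.comp_of_eq (g := H0) (f := fun q : ℂ × X => (g (χ q, q.2), (χ q, q.2)))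
      hH0 (hgχ.prod hχs) (by simp only [hχs0, hg0]; rfl)
  · rw [hψd.deriv]; exact hb0
  · simp [c, hm0]
    exact hg0
  · intro v
    have hfd := hf.differentiableAt.hasFDerivAt
    have hmd := hm.differentiableAt.hasFDerivAt
    have hgd : HasFDerivAt g (fderiv ℂ f 0 - ContinuousLinearMap.fst ℂ ℂ X) (m 0, 0) := by
      rw [hmid0]
      exact hfd.sub hasFDerivAt_fst
    have hcd := (HasFDerivAt.comp (f := fun η : X => (m η, η)) (0 : X) hgd
      (hmd.prodMk (hasFDerivAt_id (0 : X)))).neg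
    have e1 : fderiv ℂ c 0 = _ := hcd.fderiv
    have e2 : fderiv ℂ f 0 (1, 0) = 1 := by
      have d1 : HasDerivAt (fun z : ℂ => (z, (0 : X))) (1, 0) 0 :=
        (hasDerivAt_id (0 : ℂ)).prodMk (hasDerivAt_const _ _)
      refine Eq.trans ?_ h1
      exact (HasFDerivAt.comp_hasDerivAt (f := fun z : ℂ => (z, (0 : X))) (0 : ℂ) hfd
        d1).deriv.symm
    rw [e1]
    have e3 : ((fderiv ℂ m 0 v, v) : ℂ × X) = (fderiv ℂ m 0 v) • ((1 : ℂ), (0 : X)) + (0, v) := by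
      ext <;> simp
    simp only [neg_apply, ContinuousLinearMap.comp_apply,
      ContinuousLinearMap.prod_apply, sub_apply, ContinuousLinearMap.id_apply]
    rw [e3, map_add, map_smul, e2]
    simp
  · show H0 (g (χ 0, (0 : ℂ × X).2), (χ 0, (0 : ℂ × X).2)) ≠ 0
    rw [hχs0, hg0]
    change H0 0 ≠ 0
    rw [hH0b]; exact hb0
  · have ht : Tendsto (fun p : ℂ × X => (g p, p)) (𝓝 0) (𝓝 0) :=
      tendsto_zero_of (hg.prod analyticAt_id) (by simp [hg0])
    filter_upwards [ht.eventually hψH, hχl, hgψ] with p e1 e2 e3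
    have e4 : p.1 + g p = f p := by simp [g]
    rw [e4] at e1
    rw [e1, e2, ← e3]

end Tools

section Uniqueness

attribute [local fun_prop] analyticAt_fst analyticAt_snd

lemma hasDerivAt_prepared {ε bv av : ℂ} {Qv : ℂ → ℂ} {s : ℂ} (hQ : DifferentiableAt ℂ Qv s)
    (hs : s ^ 2 = ε) :
    HasDerivAt (preparedMap ε bv av Qv) (1 + 2 * s * (1 + bv + av * s)) s := by
  have h1 : HasDerivAt (fun z : ℂ => z ^ 2 - ε) (2 * s) s := by
    simpa using (hasDerivAt_pow 2 s).sub_const ε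
  have h2 : HasDerivAt (fun z : ℂ => 1 + bv + av * z) av s := by
    simpa using ((hasDerivAt_id s).const_mul av).const_add (1 + bv)
  have h3 := (hasDerivAt_id s).add (h1.mul (h2.add (h1.mul hQ.hasDerivAt)))
  refine h3.congr_deriv ?_
  simp [hs]

lemma sqrt_ev {Y Z : Type*} [TopologicalSpace Y] [TopologicalSpace Z] {y0 : Y} {z0 : Z}
    {e : Y → ℂ} {h : Y → Z} (he : Tendsto e (𝓝 y0) (𝓝 0)) (hh : Tendsto h (𝓝 y0) (𝓝 z0))
    {P : ℂ × Z → Prop} (hP : ∀ᶠ p in 𝓝 ((0 : ℂ), z0), P p) :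
    ∀ᶠ y in 𝓝 y0, ∀ s : ℂ, s ^ 2 = e y → P (s, h y) := by
  rw [nhds_prod_eq] at hP
  obtain ⟨p1, h1, p2, h2, h12⟩ := eventually_prod_iff.1 hP
  obtain ⟨δ, hδ, hball⟩ := Metric.eventually_nhds_iff.1 h1
  have h3 : ∀ᶠ y in 𝓝 y0, ‖e y‖ < δ ^ 2 := by
    have := he.norm
    rw [norm_zero] at this
    exact this.eventually (gt_mem_nhds (by positivity))
  filter_upwards [h3, hh.eventually h2] with y hy hy2 s hs
  refine h12 (hball ?_) hy2
  rw [dist_zero_right]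
  rw [← hs, norm_pow] at hy
  exact lt_of_pow_lt_pow_left₀ 2 hδ.le hy

lemma normal_facts {k : ℕ} {f : ℂ → (Fin k → ℂ) → ℂ}
    (hf : AnalyticAt ℂ (fun p : ℂ × (Fin k → ℂ) => f p.1 p.2) 0) (hfix : f 0 0 = 0)
    {E : (Fin k → ℂ) → ℂ} {V : (Fin k → ℂ) → Fin (k - 1) → ℂ}
    {φ : ℂ → (Fin k → ℂ) → ℂ} {bβ bA : ℂ → (Fin (k - 1) → ℂ) → ℂ}
    {Q : ℂ → ℂ → (Fin (k - 1) → ℂ) → ℂ} {a : ℂ → (Fin (k - 1) → ℂ) → ℂ}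
    (hN : IsPreparedNormalization k f E V φ bβ bA Q a) :
    ∃ χ : ℂ × (Fin k → ℂ) → ℂ, Tendsto χ (𝓝 0) (𝓝 0) ∧
      (∀ᶠ p : ℂ × (Fin k → ℂ) in 𝓝 0, χ (φ p.1 p.2, p.2) = p.1) ∧
      (∀ᶠ q : ℂ × (Fin k → ℂ) in 𝓝 0, φ (χ q) q.2 = q.1) ∧
      (∀ᶠ q : ℂ × (Fin k → ℂ) in 𝓝 0, q.1 ^ 2 = E q.2 → f (χ q) q.2 = χ q) ∧
      (∀ᶠ p : ℂ × (Fin k → ℂ) in 𝓝 0, f p.1 p.2 = p.1 → φ p.1 p.2 ^ 2 = E p.2 ∧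
        deriv (fun z => f z p.2) p.1 = deriv (preparedMap (E p.2) (bβ (E p.2) (V p.2))
          (bA (E p.2) (V p.2)) (fun z => Q z (E p.2) (V p.2))) (φ p.1 p.2)) := by
  obtain ⟨hEV, hE0, hV0, -, hφ, hφ0, hφd, hβ, hA, hQ, hβ0, hconj, -, -, -⟩ := hN
  obtain ⟨χ, hχ, hχ0, hl, hr⟩ := inv_param hφ hφ0 hφd
  have hχt : Tendsto χ (𝓝 0) (𝓝 0) := tendsto_zero_of hχ hχ0
  refine ⟨χ, hχt, hl, hr, ?_, ?_⟩
  · have ts : Tendsto (fun q : ℂ × (Fin k → ℂ) => q.2) (𝓝 0) (𝓝 0) :=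
      continuous_snd.tendsto' _ _ rfl
    have t1 : Tendsto (fun q : ℂ × (Fin k → ℂ) => (χ q, q.2)) (𝓝 0) (𝓝 0) :=
      hχt.prodMk_nhds ts
    have t2 : Tendsto (fun q : ℂ × (Fin k → ℂ) => (f (χ q) q.2, q.2)) (𝓝 0) (𝓝 0) :=
      ((tendsto_zero_of hf hfix).comp t1).prodMk_nhds ts
    filter_upwards [hr, t1.eventually hconj, t2.eventually hl] with q h1 h2 h3 hq
    simp only [h1] at h2 h3
    rw [h2, preparedMap, hq] at h3
    simp only [sub_self, zero_mul, add_zero] at h3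
    exact h3.symm
  · -- fixed points are mapped to square roots
    have hEVs : AnalyticAt ℂ (fun p : ℂ × (Fin k → ℂ) => (E p.2, V p.2)) 0 :=
      AnalyticAt.comp_of_eq (g := fun η => (E η, V η)) (f := fun p : ℂ × (Fin k → ℂ) => p.2)
        hEV analyticAt_snd rfl
    have hEV0 : (E (0 : ℂ × (Fin k → ℂ)).2, V (0 : ℂ × (Fin k → ℂ)).2) = 0 := by
      simp [hE0, hV0]
    have cE : ContinuousAt (fun p : ℂ × (Fin k → ℂ) => E p.2) 0 := hEVs.continuousAt.fst
    have cφ := hφ.continuousAt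
    have aQ : AnalyticAt ℂ (fun p : ℂ × (Fin k → ℂ) => (φ p.1 p.2, (E p.2, V p.2))) 0 :=
      hφ.prod hEVs
    have aQ0 : (φ (0 : ℂ × (Fin k → ℂ)).1 (0 : ℂ × (Fin k → ℂ)).2,
      (E (0 : ℂ × (Fin k → ℂ)).2, V (0 : ℂ × (Fin k → ℂ)).2)) = 0 := by
      rw [hEV0]; simp [hφ0]
    have cβ : ContinuousAt (fun p : ℂ × (Fin k → ℂ) => bβ (E p.2) (V p.2)) 0 :=
      ContinuousAt.comp_of_eq (g := fun q : ℂ × (Fin (k - 1) → ℂ) => bβ q.1 q.2)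
        hβ.continuousAt hEVs.continuousAt hEV0
    have cA : ContinuousAt (fun p : ℂ × (Fin k → ℂ) => bA (E p.2) (V p.2)) 0 :=
      ContinuousAt.comp_of_eq (g := fun q : ℂ × (Fin (k - 1) → ℂ) => bA q.1 q.2)
        hA.continuousAt hEVs.continuousAt hEV0
    have cQ : ContinuousAt (fun p : ℂ × (Fin k → ℂ) => Q (φ p.1 p.2) (E p.2) (V p.2)) 0 :=
      ContinuousAt.comp_of_eq (g := fun q : ℂ × ℂ × (Fin (k - 1) → ℂ) => Q q.1 q.2.1 q.2.2)
        hQ.continuousAt aQ.continuousAt aQ0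
    have hfac : ∀ᶠ p : ℂ × (Fin k → ℂ) in 𝓝 0, 1 + bβ (E p.2) (V p.2) +
        bA (E p.2) (V p.2) * φ p.1 p.2 +
        (φ p.1 p.2 ^ 2 - E p.2) * Q (φ p.1 p.2) (E p.2) (V p.2) ≠ 0 := by
      have := ((continuousAt_const (y := (1 : ℂ))).add cβ |>.add (cA.mul cφ)).add
        (((cφ.pow 2).sub cE).mul cQ)
      refine this.eventually_ne ?_
      simp [hφ0, hE0, hV0, hβ0]
    have dQ : ∀ᶠ p : ℂ × (Fin k → ℂ) in 𝓝 0, DifferentiableAt ℂ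
        (fun z => Q z (E p.2) (V p.2)) (φ p.1 p.2) := by
      have t : Tendsto (fun p : ℂ × (Fin k → ℂ) => (φ p.1 p.2, (E p.2, V p.2))) (𝓝 0) (𝓝 0) :=
        tendsto_zero_of aQ aQ0
      filter_upwards [t.eventually hQ.eventually_analyticAt] with p hp
      exact DifferentiableAt.comp (g := fun q : ℂ × ℂ × (Fin (k - 1) → ℂ) => Q q.1 q.2.1 q.2.2)
        (f := fun z : ℂ => (z, (E p.2, V p.2))) _ hp.differentiableAt (by fun_prop)
    have dφ : ∀ᶠ p : ℂ × (Fin k → ℂ) in 𝓝 0, DifferentiableAt ℂ (fun z => φ z p.2) p.1 := by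
      filter_upwards [hφ.eventually_analyticAt] with p hp
      exact DifferentiableAt.comp (g := fun q : ℂ × (Fin k → ℂ) => φ q.1 q.2)
        (f := fun z : ℂ => (z, p.2)) _ hp.differentiableAt (by fun_prop)
    have df : ∀ᶠ p : ℂ × (Fin k → ℂ) in 𝓝 0, DifferentiableAt ℂ (fun z => f z p.2) p.1 := by
      filter_upwards [hf.eventually_analyticAt] with p hp
      exact DifferentiableAt.comp (g := fun q : ℂ × (Fin k → ℂ) => f q.1 q.2)
        (f := fun z : ℂ => (z, p.2)) _ hp.differentiableAt (by fun_prop)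
    have dχ : ∀ᶠ p : ℂ × (Fin k → ℂ) in 𝓝 0,
        DifferentiableAt ℂ (fun w => χ (w, p.2)) (φ p.1 p.2) := by
      have t : Tendsto (fun p : ℂ × (Fin k → ℂ) => (φ p.1 p.2, p.2)) (𝓝 0) (𝓝 0) :=
        tendsto_zero_of (hφ.prod analyticAt_snd) (by simp [hφ0])
      filter_upwards [t.eventually hχ.eventually_analyticAt] with p hp
      exact DifferentiableAt.comp (g := χ)
        (f := fun z : ℂ => (z, p.2)) _ hp.differentiableAt (by fun_prop)
    filter_upwards [hfac, dQ, dφ, df, dχ, hl.eventually_nhds, hconj.eventually_nhds]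
      with p h1 h2 h3 h4 h5 h6 h7 hp
    have hsq : φ p.1 p.2 ^ 2 = E p.2 := by
      have h8 := h7.self_of_nhds
      rw [hp, preparedMap] at h8
      have h9 := (left_eq_add.1 h8)
      exact sub_eq_zero.1 ((mul_eq_zero.1 h9).resolve_right h1)
    refine ⟨hsq, ?_⟩
    have tp : Tendsto (fun z : ℂ => (z, p.2)) (𝓝 p.1) (𝓝 p) :=
      Continuous.tendsto' (by fun_prop) _ _ rfl
    have dP := hasDerivAt_prepared (bv := bβ (E p.2) (V p.2)) (av := bA (E p.2) (V p.2)) h2 hsq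
    rw [dP.deriv]
    have d1 := HasDerivAt.comp (h₂ := preparedMap (E p.2) (bβ (E p.2) (V p.2))
      (bA (E p.2) (V p.2)) (fun z => Q z (E p.2) (V p.2))) (h := fun z => φ z p.2) p.1 dP
      h3.hasDerivAt
    have d2 : HasDerivAt (fun z => φ (f z p.2) p.2) (deriv (fun z => φ z p.2) p.1 *
        deriv (fun z => f z p.2) p.1) p.1 :=
      HasDerivAt.comp (h₂ := fun z => φ z p.2) (h := fun z => f z p.2) p.1
        (by rw [hp]; exact h3.hasDerivAt) h4.hasDerivAt
    have d3 := d1.congr_of_eventuallyEq (f₁ := fun z => φ (f z p.2) p.2) (tp.eventually h7)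
    have d4 := HasDerivAt.comp (h₂ := fun w => χ (w, p.2)) (h := fun z => φ z p.2) p.1
      h5.hasDerivAt h3.hasDerivAt
    have d5 := (hasDerivAt_id p.1).congr_of_eventuallyEq
      (f₁ := (fun w => χ (w, p.2)) ∘ fun z => φ z p.2) (tp.eventually h6)
    have hne : deriv (fun z => φ z p.2) p.1 ≠ 0 := by
      intro h0
      have := d4.unique d5
      rw [h0] at this
      simp at this
    have := d2.unique d3
    exact mul_left_cancel₀ hne (this.trans (mul_comm _ _))

lemma uniq_half {k : ℕ} {f : ℂ → (Fin k → ℂ) → ℂ}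
    (hf : AnalyticAt ℂ (fun p : ℂ × (Fin k → ℂ) => f p.1 p.2) 0) (hfix : f 0 0 = 0)
    {E : (Fin k → ℂ) → ℂ} {V : (Fin k → ℂ) → Fin (k - 1) → ℂ}
    {φ : ℂ → (Fin k → ℂ) → ℂ} {bβ bA : ℂ → (Fin (k - 1) → ℂ) → ℂ}
    {Q : ℂ → ℂ → (Fin (k - 1) → ℂ) → ℂ} {a : ℂ → (Fin (k - 1) → ℂ) → ℂ}
    (hN : IsPreparedNormalization k f E V φ bβ bA Q a)
    {E' : (Fin k → ℂ) → ℂ} {V' : (Fin k → ℂ) → Fin (k - 1) → ℂ}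
    {φ' : ℂ → (Fin k → ℂ) → ℂ} {bβ' bA' : ℂ → (Fin (k - 1) → ℂ) → ℂ}
    {Q' : ℂ → ℂ → (Fin (k - 1) → ℂ) → ℂ} {a' : ℂ → (Fin (k - 1) → ℂ) → ℂ}
    (hN' : IsPreparedNormalization k f E' V' φ' bβ' bA' Q' a') :
    ∀ᶠ η in 𝓝 (0 : Fin k → ℂ), E' η ≠ 0 → E' η = E η := by
  obtain ⟨χ, hχ, hl, hr, hfx, hmul⟩ := normal_facts hf hfix hN
  obtain ⟨χ', hχ', hl', hr', hfx', hmul'⟩ := normal_facts hf hfix hN'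
  obtain ⟨hEV, hE0, hV0, -, hφ, hφ0, -, -, -, -, -, -, hid, -, -⟩ := hN
  obtain ⟨hEV', hE0', hV0', -, hφ', hφ0', -, -, -, -, -, -, hid', -, -⟩ := hN'
  have tE : Tendsto (fun η => (E η, V η)) (𝓝 0) (𝓝 0) :=
    tendsto_zero_of hEV (by simp [hE0, hV0])
  have tE' : Tendsto (fun η => (E' η, V' η)) (𝓝 0) (𝓝 0) :=
    tendsto_zero_of hEV' (by simp [hE0', hV0'])
  have tE1 : Tendsto E' (𝓝 0) (𝓝 0) := (continuous_fst.tendsto' _ _ rfl).comp tE'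
  have t1 : Tendsto (fun q : ℂ × (Fin k → ℂ) => (χ' q, q.2)) (𝓝 0) (𝓝 0) :=
    hχ'.prodMk_nhds (continuous_snd.tendsto' _ _ rfl)
  have big := sqrt_ev tE1 (tendsto_id (x := 𝓝 (0 : Fin k → ℂ)))
    (((hr'.and hfx').and ((t1.eventually hmul).and (t1.eventually hmul'))).and (t1.eventually hl))
  filter_upwards [big, tE.eventually hid, tE'.eventually hid'] with η hb hi hi' hne
  obtain ⟨s, hs⟩ : ∃ s : ℂ, s ^ 2 = E' η := IsAlgClosed.exists_pow_nat_eq (E' η) two_pos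
  have hs0 : s ≠ 0 := by rintro rfl; exact hne (by rw [← hs]; simp)
  obtain ⟨⟨⟨a1, a2⟩, a3, a4⟩, a5⟩ := hb s hs
  obtain ⟨⟨⟨b1, b2⟩, b3, b4⟩, b5⟩ := hb (-s) (by rw [neg_sq]; exact hs)
  simp only [id] at a1 a2 a3 a4 a5 b1 b2 b3 b4 b5
  have a2 := a2 hs
  have b2 := b2 (by rw [neg_sq]; exact hs)
  obtain ⟨a3, a3'⟩ := a3 a2
  obtain ⟨a4, a4'⟩ := a4 a2
  obtain ⟨b3, b3'⟩ := b3 b2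
  obtain ⟨b4, b4'⟩ := b4 b2
  rw [a1] at a4'
  rw [b1] at b4'
  have hz : χ' (s, η) ≠ χ' (-s, η) := by
    intro h
    rw [h, b1] at a1
    exact hs0 (self_eq_neg.1 a1.symm)
  have hw : φ (χ' (s, η)) η ≠ φ (χ' (-s, η)) η := by
    intro h
    rw [h, b5] at a5
    exact hz a5.symm
  have hww : φ (χ' (-s, η)) η = - φ (χ' (s, η)) η := by
    rcases sq_eq_sq_iff_eq_or_eq_neg.1 (b3.trans a3.symm) with h | h
    · exact absurd h.symm hw
    · exact h
  have hw0 : φ (χ' (s, η)) η ≠ 0 := by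
    intro h
    rw [hww, h] at hw
    simp at hw
  have i1 := hi _ hw0 a3
  have i2 := hi' s hs0 hs
  rw [← hww, ← a3', ← b3', a4', b4', ← i2] at i1
  have : φ (χ' (s, η)) η = s := by
    simpa using i1
  rw [← a3, this, hs]

lemma uniq {k : ℕ} {f : ℂ → (Fin k → ℂ) → ℂ}
    (hf : AnalyticAt ℂ (fun p : ℂ × (Fin k → ℂ) => f p.1 p.2) 0) (hfix : f 0 0 = 0)
    {E : (Fin k → ℂ) → ℂ} {V : (Fin k → ℂ) → Fin (k - 1) → ℂ}
    {φ : ℂ → (Fin k → ℂ) → ℂ} {bβ bA : ℂ → (Fin (k - 1) → ℂ) → ℂ}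
    {Q : ℂ → ℂ → (Fin (k - 1) → ℂ) → ℂ} {a : ℂ → (Fin (k - 1) → ℂ) → ℂ}
    (hN : IsPreparedNormalization k f E V φ bβ bA Q a)
    {E' : (Fin k → ℂ) → ℂ} {V' : (Fin k → ℂ) → Fin (k - 1) → ℂ}
    {φ' : ℂ → (Fin k → ℂ) → ℂ} {bβ' bA' : ℂ → (Fin (k - 1) → ℂ) → ℂ}
    {Q' : ℂ → ℂ → (Fin (k - 1) → ℂ) → ℂ} {a' : ℂ → (Fin (k - 1) → ℂ) → ℂ}
    (hN' : IsPreparedNormalization k f E' V' φ' bβ' bA' Q' a') :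
    E' =ᶠ[𝓝 (0 : Fin k → ℂ)] E := by
  filter_upwards [uniq_half hf hfix hN hN', uniq_half hf hfix hN' hN] with η h1 h2
  by_cases h : E' η = 0
  · by_cases h' : E η = 0
    · rw [h, h']
    · exact (h2 h').symm
  · exact h1 h

end Uniqueness

section Existence

attribute [local fun_prop] analyticAt_fst analyticAt_snd

lemma stage1 {X : Type*} [NormedAddCommGroup X] [NormedSpace ℂ X] [CompleteSpace X]
    {f : ℂ × X → ℂ} (hf : AnalyticAt ℂ f 0) (hf0 : f 0 = 0)
    (h1 : deriv (fun z => f (z, 0)) 0 = 1)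
    (h2 : deriv (deriv (fun z => f (z, 0))) 0 ≠ 0) :
    ∃ (φ : ℂ × X → ℂ) (E : X → ℂ) (K : ℂ × X → ℂ) (α : X → ℂ),
      AnalyticAt ℂ φ 0 ∧ AnalyticAt ℂ E 0 ∧ AnalyticAt ℂ K 0 ∧ AnalyticAt ℂ α 0 ∧
      φ 0 = 0 ∧ deriv (fun z => φ (z, 0)) 0 ≠ 0 ∧ E 0 = 0 ∧
      (∃ r : ℂ, r ≠ 0 ∧ ∀ v, fderiv ℂ E 0 v = r * fderiv ℂ f 0 (0, v)) ∧ K 0 = 1 ∧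
      (∀ᶠ p in 𝓝 (0 : ℂ × X), φ (f p, p.2) = φ p + (φ p ^ 2 - E p.2) * K (φ p, p.2)) ∧
      (∀ᶠ η in 𝓝 (0 : X), ∀ s : ℂ, s ^ 2 = E η → s ≠ 0 →
        1 / s = 1 / Complex.log (1 + 2 * s * K (s, η)) -
          1 / Complex.log (1 + 2 * (-s) * K (-s, η)) ∧
        α η = 1 / Complex.log (1 + 2 * s * K (s, η)) +
          1 / Complex.log (1 + 2 * (-s) * K (-s, η))) := by
  obtain ⟨ψ, c, H, hψ, hc, hH, hψ0, hψd, hc0, hcd, hH0, hconj⟩ := lemmaA hf hf0 h1 h2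
  obtain ⟨n, o, hn, ho, hnH, hlog⟩ := lemmaB hH hH0
  have hn0 : n 0 ≠ 0 := left_ne_zero_of_mul (hnH ▸ one_ne_zero)
  have hcη : AnalyticAt ℂ (fun η : X => (c η, η)) 0 := hc.prod analyticAt_id
  have hcη0 : (c (0 : X), (0 : X)) = 0 := by rw [hc0]; rfl
  have hnc : AnalyticAt ℂ (fun η : X => n (c η, η)) 0 :=
    AnalyticAt.comp_of_eq (g := n) (f := fun η : X => (c η, η)) hn hcη hcη0
  have hoc : AnalyticAt ℂ (fun η : X => o (c η, η)) 0 :=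
    AnalyticAt.comp_of_eq (g := o) (f := fun η : X => (c η, η)) ho hcη hcη0
  -- `m η = 1 / κ η`
  set m : X → ℂ := fun η => n (c η, η) with hm
  have hm0 : m 0 = n 0 := by simp only [hm, hcη0]
  have hm0' : m 0 ≠ 0 := by rw [hm0]; exact hn0
  have hκ : AnalyticAt ℂ (fun η => (m η)⁻¹) 0 := hnc.inv hm0'
  have hκ2 : AnalyticAt ℂ (fun p : ℂ × X => (m p.2)⁻¹) 0 :=
    AnalyticAt.comp_of_eq (g := fun η => (m η)⁻¹) (f := fun p : ℂ × X => p.2) hκ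
      analyticAt_snd rfl
  have hm2 : AnalyticAt ℂ (fun p : ℂ × X => m p.2) 0 :=
    AnalyticAt.comp_of_eq (g := m) (f := fun p : ℂ × X => p.2) hnc analyticAt_snd rfl
  have hmne : ∀ᶠ η in 𝓝 (0 : X), m η ≠ 0 := hnc.continuousAt.eventually_ne hm0'
  have hin : AnalyticAt ℂ (fun p : ℂ × X => (p.1 * m p.2, p.2)) 0 :=
    (analyticAt_fst.mul hm2).prod analyticAt_snd
  have ts : Tendsto (fun q : ℂ × X => q.2) (𝓝 0) (𝓝 0) := continuous_snd.tendsto' _ _ rfl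
  refine ⟨fun p => (m p.2)⁻¹ * ψ p, fun η => c η * (m η)⁻¹ ^ 2,
    fun p => m p.2 * H (p.1 * m p.2, p.2), fun η => o (c η, η), hκ2.mul hψ, hc.mul (hκ.pow 2),
    hm2.mul (AnalyticAt.comp_of_eq (g := H) (f := fun p : ℂ × X => (p.1 * m p.2, p.2)) hH hin
      (by simp)), hoc, by simp [hψ0], ?_, by simp [hc0], ⟨-((m 0)⁻¹ ^ 2), ?_, ?_⟩, ?_, ?_, ?_⟩
  · have : DifferentiableAt ℂ (fun z => ψ (z, 0)) 0 :=
      differentiableAt_of_deriv_ne_zero hψd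
    simp only
    rw [deriv_const_mul _ this]
    exact mul_ne_zero (inv_ne_zero hm0') hψd
  · exact neg_ne_zero.2 (pow_ne_zero _ (inv_ne_zero hm0'))
  · intro v
    rw [fderiv_fun_mul hc.differentiableAt (d := fun η => (m η)⁻¹ ^ 2)
      (hκ.pow 2).differentiableAt]
    simp [hc0, hcd v]
  · simp only [Prod.snd_zero, Prod.fst_zero, zero_mul, hm0]
    exact hnH
  · filter_upwards [hconj, ts.eventually hmne] with p hp hne
    simp only [hp]
    have : (m p.2)⁻¹ * ψ p * m p.2 = ψ p := by field_simp
    rw [this]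
    field_simp
  · have hE : Tendsto c (𝓝 0) (𝓝 0) := tendsto_zero_of hc hc0
    filter_upwards [sqrt_ev hE (tendsto_id (x := 𝓝 (0 : X))) hlog, hmne] with η hη hne s hs hs0
    have hs' : (s * m η) ^ 2 = c η := by
      rw [mul_pow, hs]; field_simp
    obtain ⟨e1, e2⟩ := hη (s * m η) hs' (mul_ne_zero hs0 hne)
    simp only [id, hs'] at e1 e2
    have r1 : 1 + 2 * s * (m η * H (s * m η, η)) = 1 + 2 * (s * m η) * H (s * m η, η) := by ring
    have r2 : 1 + 2 * (-s) * (m η * H (-s * m η, η)) =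
      1 + 2 * (-(s * m η)) * H (-(s * m η), η) := by rw [neg_mul s]; ring
    rw [r1, r2, e1, e2]
    refine ⟨?_, rfl⟩
    change 1 / s = m η / (s * m η)
    field_simp

lemma param_change {m : ℕ} {E : (Fin (m + 1) → ℂ) → ℂ} (hE : AnalyticAt ℂ E 0) (hE0 : E 0 = 0)
    (j : Fin (m + 1)) (hj : fderiv ℂ E 0 (Pi.single j 1) ≠ 0) :
    ∃ V : (Fin (m + 1) → ℂ) → Fin m → ℂ, AnalyticAt ℂ (fun η => (E η, V η)) 0 ∧ V 0 = 0 ∧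
      ∃ G : ℂ × (Fin m → ℂ) → Fin (m + 1) → ℂ, AnalyticAt ℂ G 0 ∧ G 0 = 0 ∧
        (∀ᶠ η in 𝓝 0, G (E η, V η) = η) ∧ (∀ᶠ p in 𝓝 0, (E (G p), V (G p)) = p) := by
  let W : (Fin (m + 1) → ℂ) →L[ℂ] (Fin m → ℂ) :=
    ContinuousLinearMap.pi (fun i => ContinuousLinearMap.proj (j.succAbove i))
  have hW : ∀ η i, W η i = η (j.succAbove i) := fun η i => rfl
  have hd : HasFDerivAt (fun η => (E η, W η)) ((fderiv ℂ E 0).prod W) 0 :=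
    hE.differentiableAt.hasFDerivAt.prodMk W.hasFDerivAt
  have hinj : Function.Injective (((fderiv ℂ E 0).prod W : _ →L[ℂ] _) :
      (Fin (m + 1) → ℂ) →ₗ[ℂ] ℂ × (Fin m → ℂ)) := by
    rw [← LinearMap.ker_eq_bot, LinearMap.ker_eq_bot']
    intro v hv
    have hv1 : fderiv ℂ E 0 v = 0 := congrArg Prod.fst hv
    have hv2 : W v = 0 := congrArg Prod.snd hv
    have hvj : v = v j • Pi.single j 1 := by
      funext i
      by_cases h : i = j
      · subst h; simp
      · obtain ⟨i', rfl⟩ := Fin.exists_succAbove_eq h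
        have := congrFun hv2 i'
        rw [hW] at this
        simp [this]
    rw [hvj, map_smul, smul_eq_mul] at hv1
    rcases mul_eq_zero.1 hv1 with h | h
    · rw [hvj, h, zero_smul]
    · exact absurd h hj
  have hfr : Module.finrank ℂ (Fin (m + 1) → ℂ) = Module.finrank ℂ (ℂ × (Fin m → ℂ)) := by
    simp [add_comm]
  let L := (LinearEquiv.ofInjectiveOfFinrankEq _ hinj hfr).toContinuousLinearEquiv
  have hL : ((L : (Fin (m + 1) → ℂ) ≃L[ℂ] ℂ × (Fin m → ℂ)) : _ →L[ℂ] _) =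
      (fderiv ℂ E 0).prod W := by
    ext v <;> rfl
  have ha : AnalyticAt ℂ (fun η => (E η, W η)) 0 := hE.prod (W.analyticAt 0)
  obtain ⟨G, g1, g2, g3, g4⟩ := ift ha L (hL ▸ hd) (by simp [hE0])
  exact ⟨W, ha, by simp, G, g1, g2, g3, g4⟩

lemma existence {m : ℕ} {f : ℂ → (Fin (m + 1) → ℂ) → ℂ}
    (hf : AnalyticAt ℂ (fun p : ℂ × (Fin (m + 1) → ℂ) => f p.1 p.2) 0)
    (hfix : f 0 0 = 0)
    (hmult : deriv (fun z => f z 0) 0 = 1)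
    (hdouble : deriv (deriv (fun z => f z 0)) 0 ≠ 0)
    (hgen : ∃ j : Fin (m + 1), deriv (fun t : ℂ => f 0 (Pi.single j t)) 0 ≠ 0) :
    ∃ (E : (Fin (m + 1) → ℂ) → ℂ) (V : (Fin (m + 1) → ℂ) → Fin m → ℂ)
      (φ : ℂ → (Fin (m + 1) → ℂ) → ℂ) (bβ bA : ℂ → (Fin m → ℂ) → ℂ)
      (Q : ℂ → ℂ → (Fin m → ℂ) → ℂ) (a : ℂ → (Fin m → ℂ) → ℂ),
      IsPreparedNormalization (m + 1) f E V φ bβ bA Q a := by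
  obtain ⟨φ, E, K, α, hφ, hE, hK, hα, hφ0, hφd, hE0, ⟨r, hr, hrd⟩, hK0, hconj, hlog⟩ :=
    stage1 hf hfix hmult hdouble
  obtain ⟨j, hj⟩ := hgen
  have hj' : fderiv ℂ E 0 (Pi.single j 1) ≠ 0 := by
    rw [hrd]
    refine mul_ne_zero hr ?_
    have h1 : HasDerivAt (fun t : ℂ => ((0 : ℂ), (Pi.single j t : Fin (m + 1) → ℂ)))
        ((0 : ℂ), (Pi.single j 1 : Fin (m + 1) → ℂ)) 0 := by
      refine (hasDerivAt_const _ _).prodMk ?_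
      exact (ContinuousLinearMap.single ℂ (fun _ : Fin (m + 1) => ℂ) j).hasDerivAt
    have h2 : HasFDerivAt (fun p : ℂ × (Fin (m + 1) → ℂ) => f p.1 p.2)
        (fderiv ℂ (fun p : ℂ × (Fin (m + 1) → ℂ) => f p.1 p.2) 0)
        ((fun t : ℂ => ((0 : ℂ), (Pi.single j t : Fin (m + 1) → ℂ))) 0) := by
      have : ((fun t : ℂ => ((0 : ℂ), (Pi.single j t : Fin (m + 1) → ℂ))) 0) = 0 := by
        simp
      rw [this]
      exact hf.differentiableAt.hasFDerivAt
    have h3 := h2.comp_hasDerivAt 0 h1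
    rw [← h3.deriv]
    exact hj
  obtain ⟨V, hEV, hV0, G, hG, hG0, hGl, hGr⟩ := param_change hE hE0 j hj'
  obtain ⟨k0, k1, hk0, hk1, hkK⟩ := even_odd hK
  obtain ⟨D0, hD0, hd0⟩ := divdiff hk0
  obtain ⟨D1, hD1, hd1⟩ := divdiff hk1
  have hk00 : k0 0 = 1 := by
    have := hkK.self_of_nhds
    rw [hK0] at this
    have h : k0 (0, 0) = 1 := by simpa using this.symm
    exact h
  have tG : Tendsto G (𝓝 0) (𝓝 0) := tendsto_zero_of hG hG0
  have tEV : Tendsto (fun η => (E η, V η)) (𝓝 0) (𝓝 0) :=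
    tendsto_zero_of hEV (by simp [hE0, hV0])
  have aG : AnalyticAt ℂ (fun q : ℂ × (Fin m → ℂ) => (q.1, G q)) 0 := analyticAt_fst.prod hG
  have aG0 : ((0 : ℂ × (Fin m → ℂ)).1, G 0) = 0 := by rw [hG0]; rfl
  have aβ : AnalyticAt ℂ (fun q : ℂ × (Fin m → ℂ) => k0 (q.1, G q)) 0 :=
    AnalyticAt.comp_of_eq (g := k0) (f := fun q : ℂ × (Fin m → ℂ) => (q.1, G q)) hk0 aG aG0
  have aA : AnalyticAt ℂ (fun q : ℂ × (Fin m → ℂ) => k1 (q.1, G q)) 0 :=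
    AnalyticAt.comp_of_eq (g := k1) (f := fun q : ℂ × (Fin m → ℂ) => (q.1, G q)) hk1 aG aG0
  have aGs : AnalyticAt ℂ (fun q : ℂ × ℂ × (Fin m → ℂ) => (q.2.1, G q.2)) 0 :=
    AnalyticAt.comp_of_eq (g := fun q : ℂ × (Fin m → ℂ) => (q.1, G q))
      (f := fun q : ℂ × ℂ × (Fin m → ℂ) => q.2) aG analyticAt_snd rfl
  have a3 : AnalyticAt ℂ (fun q : ℂ × ℂ × (Fin m → ℂ) =>
      (q.1 ^ 2 - q.2.1, (q.2.1, G q.2))) 0 := by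
    refine AnalyticAt.prod ?_ aGs
    fun_prop
  have a30 : ((0 : ℂ × ℂ × (Fin m → ℂ)).1 ^ 2 - (0 : ℂ × ℂ × (Fin m → ℂ)).2.1,
      ((0 : ℂ × ℂ × (Fin m → ℂ)).2.1, G (0 : ℂ × ℂ × (Fin m → ℂ)).2)) = 0 := by
    simp [hG0]
  have aQ : AnalyticAt ℂ (fun q : ℂ × ℂ × (Fin m → ℂ) =>
      D0 (q.1 ^ 2 - q.2.1, (q.2.1, G q.2)) + q.1 * D1 (q.1 ^ 2 - q.2.1, (q.2.1, G q.2))) 0 :=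
    (AnalyticAt.comp_of_eq (g := D0) hD0 a3 a30).add
      (analyticAt_fst.mul (AnalyticAt.comp_of_eq (g := D1) hD1 a3 a30))
  have t3 := tendsto_zero_of a3 a30
  have tzG : Tendsto (fun q : ℂ × ℂ × (Fin m → ℂ) => (q.1, G q.2)) (𝓝 0) (𝓝 0) :=
    (continuous_fst.tendsto' _ _ rfl).prodMk_nhds
      (tG.comp (continuous_snd.tendsto' _ _ rfl))
  -- the key identity
  have key : ∀ᶠ q : ℂ × ℂ × (Fin m → ℂ) in 𝓝 0,
      1 + (k0 (q.2.1, G q.2) - 1) + k1 (q.2.1, G q.2) * q.1 + (q.1 ^ 2 - q.2.1) *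
      (D0 (q.1 ^ 2 - q.2.1, (q.2.1, G q.2)) + q.1 * D1 (q.1 ^ 2 - q.2.1, (q.2.1, G q.2))) =
      K (q.1, G q.2) := by
    filter_upwards [tzG.eventually hkK, t3.eventually hd0, t3.eventually hd1] with q e1 e2 e3
    simp only [add_sub_cancel] at e1 e2 e3
    rw [e1, e2, e3]
    ring
  -- multipliers
  have tq1 : Tendsto (fun q : ℂ × (Fin m → ℂ) => q.1) (𝓝 0) (𝓝 0) :=
    continuous_fst.tendsto' _ _ rfl
  have mult : ∀ᶠ q : ℂ × (Fin m → ℂ) in 𝓝 0, ∀ s : ℂ, s ^ 2 = q.1 →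
      deriv (preparedMap q.1 (k0 (q.1, G q) - 1) (k1 (q.1, G q))
        (fun z => D0 (z ^ 2 - q.1, (q.1, G q)) + z * D1 (z ^ 2 - q.1, (q.1, G q)))) s =
      1 + 2 * s * K (s, G q) := by
    filter_upwards [sqrt_ev tq1 (tendsto_id (x := 𝓝 (0 : ℂ × (Fin m → ℂ))))
      (key.and aQ.eventually_analyticAt)] with q hq s hs
    obtain ⟨e1, e2⟩ := hq s hs
    have hdQ : DifferentiableAt ℂ
        (fun z => D0 (z ^ 2 - q.1, (q.1, G q)) + z * D1 (z ^ 2 - q.1, (q.1, G q))) s :=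
      DifferentiableAt.comp (g := fun q : ℂ × ℂ × (Fin m → ℂ) =>
          D0 (q.1 ^ 2 - q.2.1, (q.2.1, G q.2)) + q.1 * D1 (q.1 ^ 2 - q.2.1, (q.2.1, G q.2)))
        (f := fun z : ℂ => (z, q)) s e2.differentiableAt (by fun_prop)
    rw [(hasDerivAt_prepared hdQ hs).deriv]
    simp only [id, hs, sub_self, zero_mul, add_zero] at e1
    rw [e1]
  have final : ∀ᶠ q : ℂ × (Fin m → ℂ) in 𝓝 0, ∀ s : ℂ, s ≠ 0 → s ^ 2 = q.1 →
      (1 / s =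
        1 / Complex.log (deriv (preparedMap q.1 (k0 (q.1, G q) - 1) (k1 (q.1, G q))
        (fun z => D0 (z ^ 2 - q.1, (q.1, G q)) + z * D1 (z ^ 2 - q.1, (q.1, G q)))) s) -
        1 / Complex.log (deriv (preparedMap q.1 (k0 (q.1, G q) - 1) (k1 (q.1, G q))
        (fun z => D0 (z ^ 2 - q.1, (q.1, G q)) + z * D1 (z ^ 2 - q.1, (q.1, G q)))) (-s))) ∧
      (α (G q) =
        1 / Complex.log (deriv (preparedMap q.1 (k0 (q.1, G q) - 1) (k1 (q.1, G q))
        (fun z => D0 (z ^ 2 - q.1, (q.1, G q)) + z * D1 (z ^ 2 - q.1, (q.1, G q)))) s) +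
        1 / Complex.log (deriv (preparedMap q.1 (k0 (q.1, G q) - 1) (k1 (q.1, G q))
        (fun z => D0 (z ^ 2 - q.1, (q.1, G q)) + z * D1 (z ^ 2 - q.1, (q.1, G q)))) (-s))) := by
    filter_upwards [mult, tG.eventually hlog, hGr] with q h1 h2 h3 s hs0 hs
    rw [h1 s hs, h1 (-s) (by rw [neg_sq]; exact hs)]
    have hE1 : E (G q) = q.1 := congrArg Prod.fst h3
    exact h2 s (hs.trans hE1.symm) hs0
  refine ⟨E, V, fun z η => φ (z, η), fun e ν => k0 (e, G (e, ν)) - 1,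
    fun e ν => k1 (e, G (e, ν)),
    fun z e ν => D0 (z ^ 2 - e, (e, G (e, ν))) + z * D1 (z ^ 2 - e, (e, G (e, ν))),
    fun e ν => α (G (e, ν)), hEV, hE0, hV0, ⟨G, hG, hGl, hGr⟩, hφ, hφ0, hφd,
    aβ.sub analyticAt_const, aA, aQ, ?_, ?_, ?_, ?_, ?_⟩
  · have : ((0 : ℂ), G ((0 : ℂ), (0 : Fin m → ℂ))) = 0 := by
      rw [Prod.mk_zero_zero, hG0]; rfl
    change k0 ((0 : ℂ), G ((0 : ℂ), (0 : Fin m → ℂ))) - 1 = 0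
    rw [this, hk00, sub_self]
  · have ts : Tendsto (fun q : ℂ × (Fin (m + 1) → ℂ) => q.2) (𝓝 0) (𝓝 0) :=
      continuous_snd.tendsto' _ _ rfl
    have t4 : Tendsto (fun p : ℂ × (Fin (m + 1) → ℂ) => (φ p, (E p.2, V p.2))) (𝓝 0) (𝓝 0) :=
      (tendsto_zero_of hφ hφ0).prodMk_nhds (tEV.comp ts)
    filter_upwards [hconj, t4.eventually key, ts.eventually hGl] with p e1 e2 e3
    rw [e3] at e2
    simp only [preparedMap, e1, e3, e2, Prod.mk.eta]
  · filter_upwards [final] with q hq s hs0 hs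
    exact (hq s hs0 hs).1
  · exact AnalyticAt.comp_of_eq (g := α) hα hG hG0
  · filter_upwards [final] with q hq s hs0 hs
    exact (hq s hs0 hs).2

end Existence

/-- Preparation theorem for generic `k`-parameter unfoldings of a codimension-one
parabolic fixed point: any such family can be brought to the prepared form, and the
canonical parameter `ε` is unique. -/
theorem stmt_0 (k : ℕ) (hk : 1 ≤ k) (f : ℂ → (Fin k → ℂ) → ℂ)
    (hf : AnalyticAt ℂ (fun p : ℂ × (Fin k → ℂ) => f p.1 p.2) (0 : ℂ × (Fin k → ℂ)))
    (hfix : f 0 0 = 0)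
    (hmult : deriv (fun z => f z 0) 0 = 1)
    (hdouble : deriv (deriv (fun z => f z 0)) 0 ≠ 0)
    (hgen : ∃ j : Fin k, deriv (fun t : ℂ => f 0 (Pi.single j t)) 0 ≠ 0) :
    ∃ (E : (Fin k → ℂ) → ℂ) (V : (Fin k → ℂ) → Fin (k - 1) → ℂ)
      (φ : ℂ → (Fin k → ℂ) → ℂ) (bβ bA : ℂ → (Fin (k - 1) → ℂ) → ℂ)
      (Q : ℂ → ℂ → (Fin (k - 1) → ℂ) → ℂ) (a : ℂ → (Fin (k - 1) → ℂ) → ℂ),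
      IsPreparedNormalization k f E V φ bβ bA Q a ∧
      -- uniqueness of the canonical parameter
      ∀ (E' : (Fin k → ℂ) → ℂ) (V' : (Fin k → ℂ) → Fin (k - 1) → ℂ)
        (φ' : ℂ → (Fin k → ℂ) → ℂ) (bβ' bA' : ℂ → (Fin (k - 1) → ℂ) → ℂ)
        (Q' : ℂ → ℂ → (Fin (k - 1) → ℂ) → ℂ) (a' : ℂ → (Fin (k - 1) → ℂ) → ℂ),
        IsPreparedNormalization k f E' V' φ' bβ' bA' Q' a' →
        E' =ᶠ[nhds (0 : Fin k → ℂ)] E := by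
  obtain ⟨m, rfl⟩ : ∃ m, k = m + 1 := ⟨k - 1, by omega⟩
  obtain ⟨E, V, φ, bβ, bA, Q, a, hN⟩ := existence hf hfix hmult hdouble hgen
  exact ⟨E, V, φ, bβ, bA, Q, a, hN, fun E' V' φ' bβ' bA' Q' a' hN' => uniq hf hfix hN hN'⟩
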